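/- Let H be a bipartite simple graph on N ≥ 10 vertices whose minimum degree exceeds 2N/5. Then H is 2-connected; moreover, between any two distinct vertices of H there are two internally disjoint paths. -/

import Mathlib

/-- A graph is `m`-cycle-free if it contains no cycle of length `m`. -/
def SimpleGraph.CycleFree {V : Type*} (G : SimpleGraph V) (m : ℕ) : Prop :=
  ∀ ⦃v : V⦄ (w : G.Walk v v), w.IsCycle → w.length ≠ m

/-- The spectral radius of a finite graph: the largest (real) eigenvalue of its
adjacency matrix, i.e. the supremum of the set of real eigenvalues. -/
noncomputable def SimpleGraph.specRad {V : Type*} [Fintype V] (G : SimpleGraph V) : ℝ :=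
  letI : DecidableRel G.Adj := Classical.decRel _
  sSup {μ : ℝ | ∃ x : V → ℝ, x ≠ 0 ∧ (SimpleGraph.adjMatrix ℝ G).mulVec x = μ • x}

/-- A graph is 2-connected if it has at least 3 vertices, is connected, and removing
any single vertex leaves it connected. -/
def SimpleGraph.TwoConnected {V : Type*} (G : SimpleGraph V) : Prop :=
  3 ≤ Nat.card V ∧ G.Connected ∧
    ∀ v : V, (G.induce (({v} : Set V)ᶜ)).Connected

/-- `turanSuspAt n q v0`: the `n`-vertex graph obtained from the complete bipartite graph
with parts `{0, …, q/2 - 1}` and `{q/2, …, q-1}` (the bipartite Turán graph `T_{q,2}`)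
by putting a clique on `{v0} ∪ {q, …, n-1}`; for `v0 < q` this is `T_{q,2}` with a
clique `K_{n-q+1}` suspended at the vertex `v0`. -/
def turanSuspAt (n q v0 : ℕ) : SimpleGraph (Fin n) :=
  SimpleGraph.fromRel (fun i j =>
    ((i : ℕ) < q / 2 ∧ q / 2 ≤ (j : ℕ) ∧ (j : ℕ) < q) ∨
    (((i : ℕ) = v0 ∨ q ≤ (i : ℕ)) ∧ ((j : ℕ) = v0 ∨ q ≤ (j : ℕ))))

/-- The family `𝒢_{n,r}`: graphs obtained from a bipartite graph by suspending graphs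
`G_1, …, G_s` whose parts outside the bipartite graph have at most `r - 2` vertices
in total. -/
def FamilyG (n r : ℕ) (G : SimpleGraph (Fin n)) : Prop :=
  ∃ (s : ℕ) (W : Fin s → Finset (Fin n)) (v : Fin s → Fin n),
    (∀ i j, i ≠ j → Disjoint (W i) (W j)) ∧
    (Finset.univ.biUnion W).card ≤ r - 2 ∧
    (∀ i, v i ∉ Finset.univ.biUnion W) ∧
    (∃ A : Set (Fin n), ∀ x y, G.Adj x y →
        x ∉ Finset.univ.biUnion W → y ∉ Finset.univ.biUnion W →
        ((x ∈ A ∧ y ∉ A) ∨ (x ∉ A ∧ y ∈ A))) ∧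
    (∀ i j, i ≠ j → ∀ x ∈ W i, ∀ y ∈ W j, ¬ G.Adj x y) ∧
    (∀ i, ∀ x ∈ W i, ∀ y, G.Adj x y → y ∉ Finset.univ.biUnion W → y = v i)

/-- The family `𝒢*_{n,r}`: as `FamilyG`, but with exactly `r - 2` vertices outside the
bipartite part. -/
def FamilyGStar (n r : ℕ) (G : SimpleGraph (Fin n)) : Prop :=
  ∃ (s : ℕ) (W : Fin s → Finset (Fin n)) (v : Fin s → Fin n),
    (∀ i j, i ≠ j → Disjoint (W i) (W j)) ∧
    (Finset.univ.biUnion W).card = r - 2 ∧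
    (∀ i, v i ∉ Finset.univ.biUnion W) ∧
    (∃ A : Set (Fin n), ∀ x y, G.Adj x y →
        x ∉ Finset.univ.biUnion W → y ∉ Finset.univ.biUnion W →
        ((x ∈ A ∧ y ∉ A) ∨ (x ∉ A ∧ y ∈ A))) ∧
    (∀ i j, i ≠ j → ∀ x ∈ W i, ∀ y ∈ W j, ¬ G.Adj x y) ∧
    (∀ i, ∀ x ∈ W i, ∀ y, G.Adj x y → y ∉ Finset.univ.biUnion W → y = v i)

/-- `H` is a `k`-dense bipartite graph: bipartite, 2-connected, any two distinct vertices
in the same part are joined by paths of every odd order `5 ≤ h ≤ 2k+1`, and any two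
vertices in different parts are joined by paths of every even order `6 ≤ s ≤ 2k+2`. -/
def KDenseBip {V : Type*} (k : ℕ) (H : SimpleGraph V) : Prop :=
  H.TwoConnected ∧
  ∃ A : Set V,
    (∀ ⦃x y : V⦄, H.Adj x y → ((x ∈ A ∧ y ∉ A) ∨ (x ∉ A ∧ y ∈ A))) ∧
    (∀ u v : V, u ≠ v → (u ∈ A ↔ v ∈ A) → ∀ h : ℕ, Odd h → 5 ≤ h → h ≤ 2 * k + 1 →
      ∃ p : H.Walk u v, p.IsPath ∧ p.length + 1 = h) ∧
    (∀ u v : V, ¬(u ∈ A ↔ v ∈ A) → ∀ s : ℕ, Even s → 6 ≤ s → s ≤ 2 * k + 2 →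
      ∃ p : H.Walk u v, p.IsPath ∧ p.length + 1 = s)

/-- The graph obtained from the complete bipartite graph with parts `{0, …, a}` (size `a+1`)
and `{a+1, …, a+b}` (size `b`) by identifying the vertex `0` with one vertex of a clique
on `r-1` vertices whose remaining `r-2` vertices `{a+b+1, …, a+b+r-2}` are new. -/
def bipCliqueGraph (a b r : ℕ) : SimpleGraph (Fin (a + b + r - 1)) :=
  SimpleGraph.fromRel (fun i j =>
    ((i : ℕ) ≤ a ∧ a + 1 ≤ (j : ℕ) ∧ (j : ℕ) ≤ a + b) ∨
    (((i : ℕ) = 0 ∨ a + b + 1 ≤ (i : ℕ)) ∧ ((j : ℕ) = 0 ∨ a + b + 1 ≤ (j : ℕ))))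

namespace SimpleGraph

variable {V : Type*} {H : SimpleGraph V}

/-- In a bipartite graph with minimum degree exceeding `2N/5`, two vertices in the same part
have more than `N/5` common neighbors. -/
theorem card_lt_ncard_commonNeighbors_of_bipartite [Fintype V] {A : Set V}
    (hA : ∀ ⦃x y : V⦄, H.Adj x y → ((x ∈ A ∧ y ∉ A) ∨ (x ∉ A ∧ y ∈ A)))
    (hdeg : ∀ v : V, 2 * Fintype.card V < 5 * (H.neighborSet v).ncard)
    {x y : V} (hxy : x ∈ A ↔ y ∈ A) :
    Fintype.card V < 5 * (H.commonNeighbors x y).ncard := by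
  obtain ⟨z, hz⟩ : (H.neighborSet x).Nonempty := by
    rw [← Set.ncard_pos]
    have := hdeg x
    omega
  have hdisj : Disjoint (H.neighborSet x ∪ H.neighborSet y) (H.neighborSet z) := by
    rw [Set.disjoint_left]
    intro w hw hzw
    have hxz := hA hz
    have hzw' := hA hzw
    rcases hw with hw | hw <;> have hw' := hA hw <;> tauto
  have hle : ((H.neighborSet x ∪ H.neighborSet y) ∪ H.neighborSet z).ncard ≤ Fintype.card V := by
    rw [← Nat.card_eq_fintype_card]
    exact Set.ncard_le_card _
  rw [Set.ncard_union_eq hdisj] at hle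
  have hunion := Set.ncard_union_add_ncard_inter (H.neighborSet x) (H.neighborSet y)
  rw [commonNeighbors]
  have hdx := hdeg x
  have hdy := hdeg y
  have hdz := hdeg z
  omega

/-- In a bipartite graph in which all degrees are at least three and any two vertices of the
same part have at least three common neighbors, any two vertices are joined by two internally
disjoint paths. -/
theorem exists_internally_disjoint_paths_of_bipartite {A : Set V}
    (hA : ∀ ⦃x y : V⦄, H.Adj x y → ((x ∈ A ∧ y ∉ A) ∨ (x ∉ A ∧ y ∈ A)))
    (hdeg : ∀ v : V, 2 < (H.neighborSet v).ncard)
    (hcommon : ∀ x y : V, (x ∈ A ↔ y ∈ A) → 2 < (H.commonNeighbors x y).ncard)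
    {u v : V} (huv : u ≠ v) :
    ∃ p q : H.Walk u v, p.IsPath ∧ q.IsPath ∧
      ∀ w, w ∈ p.support → w ∈ q.support → w = u ∨ w = v := by
  have avoid : ∀ (s : Set V) (a b : V), 2 < s.ncard → ∃ w ∈ s, w ≠ a ∧ w ≠ b := by
    intro s a b hs
    obtain ⟨w, hw, hwab⟩ := Set.exists_mem_notMem_of_ncard_lt_ncard
      ((Set.ncard_insert_le a {b}).trans_lt (by simpa using hs))
    exact ⟨w, hw, by simpa using hwab⟩
  by_cases hpart : u ∈ A ↔ v ∈ A
  · obtain ⟨w₁, hw₁, -, -⟩ := avoid _ u u (hcommon u v hpart)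
    obtain ⟨w₂, hw₂, hne, -⟩ := avoid _ w₁ w₁ (hcommon u v hpart)
    rw [mem_commonNeighbors] at hw₁ hw₂
    refine ⟨.cons hw₁.1 (.cons hw₁.2.symm .nil), .cons hw₂.1 (.cons hw₂.2.symm .nil), ?_, ?_, ?_⟩
    · simp [Walk.isPath_def, huv, hw₁.1.ne, hw₁.2.ne']
    · simp [Walk.isPath_def, huv, hw₂.1.ne, hw₂.2.ne']
    · simp only [Walk.support_cons, Walk.support_nil, List.mem_cons, List.not_mem_nil, or_false]
      grind
  · obtain ⟨w₁, hw₁, hw₁u, -⟩ := avoid _ u u (hdeg v)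
    obtain ⟨w₂, hw₂, hw₂u, hw₂₁⟩ := avoid _ u w₁ (hdeg v)
    rw [mem_neighborSet] at hw₁ hw₂
    have hA₁ := hA hw₁
    have hA₂ := hA hw₂
    obtain ⟨x₁, hx₁, hx₁v, -⟩ := avoid _ v v (hcommon u w₁ (by tauto))
    obtain ⟨x₂, hx₂, hx₂v, hx₂₁⟩ := avoid _ v x₁ (hcommon u w₂ (by tauto))
    rw [mem_commonNeighbors] at hx₁ hx₂
    have hB₁ := hA hx₁.1
    have hB₂ := hA hx₂.1
    have hx₁w₂ : x₁ ≠ w₂ := by rintro rfl; tauto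
    have hx₂w₁ : x₂ ≠ w₁ := by rintro rfl; tauto
    refine ⟨.cons hx₁.1 (.cons hx₁.2.symm (.cons hw₁.symm .nil)),
      .cons hx₂.1 (.cons hx₂.2.symm (.cons hw₂.symm .nil)), ?_, ?_, ?_⟩
    · simp [Walk.isPath_def, huv, hx₁.1.ne, hw₁u.symm, hx₁.2.ne', hx₁v, hw₁.ne']
    · simp [Walk.isPath_def, huv, hx₂.1.ne, hw₂u.symm, hx₂.2.ne', hx₂v, hw₂.ne']
    · simp only [Walk.support_cons, Walk.support_nil, List.mem_cons, List.not_mem_nil, or_false]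
      grind

theorem TwoConnected.of_internally_disjoint_walks (hcard : 3 ≤ Nat.card V)
    (hpaths : ∀ u v : V, u ≠ v → ∃ p q : H.Walk u v,
      ∀ w, w ∈ p.support → w ∈ q.support → w = u ∨ w = v) :
    H.TwoConnected := by
  have : Finite V := Nat.finite_of_card_ne_zero (by omega)
  have : Nontrivial V := Finite.one_lt_card_iff_nontrivial.mp (by omega)
  refine ⟨hcard, ⟨fun u v ↦ ?_⟩, fun c ↦ ?_⟩
  · obtain rfl | huv := eq_or_ne u v
    · exact .refl _
    · exact ⟨(hpaths u v huv).choose⟩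
  · obtain ⟨d, hd⟩ := exists_ne c
    have : Nonempty ({c}ᶜ : Set V) := ⟨⟨d, hd⟩⟩
    refine ⟨fun ⟨u, hu⟩ ⟨v, hv⟩ ↦ ?_⟩
    obtain rfl | huv := eq_or_ne u v
    · exact .refl _
    obtain ⟨p, q, hpq⟩ := hpaths u v huv
    obtain ⟨r, hr⟩ : ∃ r : H.Walk u v, c ∉ r.support := by
      by_contra! h
      rcases hpq c (h p) (h q) with rfl | rfl
      · exact hu rfl
      · exact hv rfl
    exact ⟨r.induce _ fun w hw (hwc : w = c) ↦ hr (hwc ▸ hw)⟩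

end SimpleGraph

/-- Let `H` be a bipartite graph on `N ≥ 10` vertices whose minimum
degree exceeds `2N/5`. Then `H` is 2-connected; moreover, between any two distinct
vertices of `H` there are two internally disjoint paths. -/
theorem stmt_13 {V : Type*} [Fintype V] (N : ℕ) (hcard : Fintype.card V = N)
    (hN : 10 ≤ N) (H : SimpleGraph V)
    (hbip : ∃ A : Set V, ∀ ⦃x y : V⦄, H.Adj x y → ((x ∈ A ∧ y ∉ A) ∨ (x ∉ A ∧ y ∈ A)))
    (hdeg : ∀ v : V, 2 * N < 5 * (H.neighborSet v).ncard) :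
    H.TwoConnected ∧
      ∀ u v : V, u ≠ v → ∃ p q : H.Walk u v, p.IsPath ∧ q.IsPath ∧
        ∀ w, w ∈ p.support → w ∈ q.support → w = u ∨ w = v := by
  subst hcard
  obtain ⟨A, hA⟩ := hbip
  have hpaths : ∀ u v : V, u ≠ v → ∃ p q : H.Walk u v, p.IsPath ∧ q.IsPath ∧
      ∀ w, w ∈ p.support → w ∈ q.support → w = u ∨ w = v := fun u v huv ↦
    SimpleGraph.exists_internally_disjoint_paths_of_bipartite hA
      (fun v ↦ by have := hdeg v; omega)
      (fun x y hxy ↦ by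
        have := SimpleGraph.card_lt_ncard_commonNeighbors_of_bipartite hA hdeg hxy
        omega) huv
  refine ⟨.of_internally_disjoint_walks (by rw [Nat.card_eq_fintype_card]; omega)
    fun u v huv ↦ ?_, hpaths⟩
  obtain ⟨p, q, -, -, h⟩ := hpaths u v huv
  exact ⟨p, q, h⟩
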